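/- Fix q ∈ (0,1), a ∈ ℝ and y ∈ ℤ_{≥0}. Then for every integer s the following three identities hold: (i) (q^s − 1)(1 + a q^{y−s}) C_a(y,s) = a (1 − q^{y+1−s}) C_a(y,s−1); (ii) C_a(y+1,s) = (1 + a q^{y−s}) C_a(y,s) − a q^{y+1−s} C_a(y,s−1); (iii) (1 + a) C_{qa}(y,s) = (1 + a q^{y−s}) C_a(y,s) + a (1 − q^{y+1−s}) C_a(y,s−1). -/

import Mathlib

/-- The q-Pochhammer symbol `(a;q)_n = ∏_{i=0}^{n-1} (1 - a q^i)`. -/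
noncomputable def qPoch (q a : ℝ) (n : ℕ) : ℝ := ∏ i ∈ Finset.range n, (1 - a * q ^ i)

/-- The coefficients `C_a(y,s) = (-a)^s (-a;q)_{y-s} (q;q)_y / ((q;q)_{y-s} (q;q)_s)`
for `0 ≤ s ≤ y`, with the convention `C_a(y,s) = 0` for `s < 0` or `s > y`. -/
noncomputable def Cco (q a : ℝ) (y : ℕ) (s : ℤ) : ℝ :=
  if 0 ≤ s ∧ s ≤ (y : ℤ) then
    (-a) ^ s.toNat * qPoch q (-a) (y - s.toNat) *
      (qPoch q q y / (qPoch q q (y - s.toNat) * qPoch q q s.toNat))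
  else 0

theorem qPoch_succ (q a : ℝ) (n : ℕ) :
    qPoch q a (n + 1) = qPoch q a n * (1 - a * q ^ n) :=
  Finset.prod_range_succ _ _

theorem qPoch_succ' (q a : ℝ) (n : ℕ) :
    qPoch q a (n + 1) = (1 - a) * qPoch q (q * a) n := by
  unfold qPoch
  rw [Finset.prod_range_succ', mul_comm]
  congr 1
  · simp
  · exact Finset.prod_congr rfl fun i _ => by ring

theorem one_sub_pow_succ_ne_zero {q : ℝ} (hq : q ∈ Set.Ioo (0 : ℝ) 1) (n : ℕ) :
    1 - q * q ^ n ≠ 0 := by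
  rw [← pow_succ']
  exact (sub_pos.2 (pow_lt_one₀ hq.1.le hq.2 n.succ_ne_zero)).ne'

theorem qPoch_self_ne_zero {q : ℝ} (hq : q ∈ Set.Ioo (0 : ℝ) 1) (n : ℕ) :
    qPoch q q n ≠ 0 :=
  Finset.prod_ne_zero_iff.2 fun i _ => one_sub_pow_succ_ne_zero hq i

theorem Cco_natCast (q a : ℝ) {y n k : ℕ} (h : y = n + k) :
    Cco q a y (k : ℤ) =
      (-a) ^ k * qPoch q (-a) n * (qPoch q q y / (qPoch q q n * qPoch q q k)) := by
  subst h
  rw [Cco, if_pos ⟨by omega, by omega⟩]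
  simp

theorem Cco_of_neg (q a : ℝ) (y : ℕ) {s : ℤ} (h : s < 0) : Cco q a y s = 0 :=
  if_neg (by omega)

theorem Cco_of_lt (q a : ℝ) (y : ℕ) {s : ℤ} (h : (y : ℤ) < s) : Cco q a y s = 0 :=
  if_neg (by omega)

theorem one_add_mul_Cco_q_mul (q a : ℝ) (y : ℕ) (s : ℤ) :
    (1 + a) * Cco q (q * a) y s =
      q ^ s * (1 + a * q ^ ((y : ℤ) - s)) * Cco q a y s := by
  rcases lt_or_ge s 0 with h | h
  · simp [Cco_of_neg _ _ _ h]
  lift s to ℕ using h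
  rcases lt_or_ge y s with h | h
  · simp [Cco_of_lt _ _ y (Nat.cast_lt.2 h)]
  obtain ⟨m, rfl⟩ := Nat.exists_eq_add_of_le' h
  have hP := (qPoch_succ' q (-a) m).symm.trans (qPoch_succ q (-a) m)
  rw [mul_neg] at hP
  rw [Cco_natCast q (q * a) rfl, Cco_natCast q a rfl,
    show ((m + s : ℕ) : ℤ) - s = (m : ℤ) by omega, zpow_natCast, zpow_natCast,
    show -(q * a) = q * -a by ring, mul_pow]
  rw [← mul_neg] at hP
  linear_combination q ^ s * (-a) ^ s *
    (qPoch q q (m + s) / (qPoch q q m * qPoch q q s)) * hP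

theorem Cco_ratio {q : ℝ} (hq : q ∈ Set.Ioo (0 : ℝ) 1) (a : ℝ) (y : ℕ) (s : ℤ) :
    (q ^ s - 1) * (1 + a * q ^ ((y : ℤ) - s)) * Cco q a y s
      = a * (1 - q ^ ((y : ℤ) + 1 - s)) * Cco q a y (s - 1) := by
  rcases lt_or_ge s 0 with h | h
  · simp [Cco_of_neg q a y h, Cco_of_neg q a y (show s - 1 < 0 by omega)]
  lift s to ℕ using h
  rcases s with _ | k
  · simp [Cco_of_neg q a y (show (-1 : ℤ) < 0 by omega)]
  rw [show ((k + 1 : ℕ) : ℤ) - 1 = (k : ℤ) by omega]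
  rcases lt_trichotomy y k with h | rfl | h
  · rw [Cco_of_lt q a y (Nat.cast_lt.2 h),
      Cco_of_lt q a y (Nat.cast_lt.2 (h.trans k.lt_succ_self))]
    simp
  · rw [Cco_of_lt q a y (Nat.cast_lt.2 y.lt_succ_self)]
    simp
  obtain ⟨m, rfl⟩ := Nat.exists_eq_add_of_le' (Nat.succ_le_of_lt h)
  rw [Cco_natCast q a (n := m) (k := k + 1) rfl,
    Cco_natCast q a (n := m + 1) (k := k) (by omega),
    show ((m + k.succ : ℕ) : ℤ) - (k + 1 : ℕ) = (m : ℤ) by omega,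
    show ((m + k.succ : ℕ) : ℤ) + 1 - (k + 1 : ℕ) = ((m + 1 : ℕ) : ℤ) by omega,
    zpow_natCast, zpow_natCast, zpow_natCast, qPoch_succ, qPoch_succ, qPoch_succ]
  have := qPoch_self_ne_zero hq m
  have := qPoch_self_ne_zero hq k
  have hm := one_sub_pow_succ_ne_zero hq m
  have hk := one_sub_pow_succ_ne_zero hq k
  simp only [pow_succ]
  generalize q ^ m = u at *
  generalize q ^ k = v at *
  have hm' : 1 - u * q ≠ 0 := mul_comm q u ▸ hm
  have hk' : 1 - v * q ≠ 0 := mul_comm q v ▸ hk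
  field_simp
  ring

theorem Cco_succ {q : ℝ} (hq : q ∈ Set.Ioo (0 : ℝ) 1) (a : ℝ) (y : ℕ) (s : ℤ) :
    Cco q a (y + 1) s
      = (1 + a * q ^ ((y : ℤ) - s)) * Cco q a y s
        - a * q ^ ((y : ℤ) + 1 - s) * Cco q a y (s - 1) := by
  rcases lt_or_ge s 0 with h | h
  · simp [Cco_of_neg q a _ h, Cco_of_neg q a y (show s - 1 < 0 by omega)]
  lift s to ℕ using h
  rcases s with _ | k
  · rw [Cco_of_neg q a y (show ((0 : ℕ) : ℤ) - 1 < 0 by omega),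
      Cco_natCast q a (y := y + 1) (n := y + 1) (k := 0) rfl,
      Cco_natCast q a (y := y) (n := y) (k := 0) rfl,
      qPoch_succ q (-a)]
    have h₀ : qPoch q q 0 = 1 := by simp [qPoch]
    have := qPoch_self_ne_zero hq y
    have := qPoch_self_ne_zero hq (y + 1)
    simp only [h₀, Nat.cast_zero, sub_zero, zpow_natCast]
    field_simp
    ring
  rw [show ((k + 1 : ℕ) : ℤ) - 1 = (k : ℤ) by omega]
  rcases lt_trichotomy y k with h | rfl | h
  · rw [Cco_of_lt q a (y + 1) (Nat.cast_lt.2 (Nat.succ_lt_succ h)),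
      Cco_of_lt q a y (Nat.cast_lt.2 h),
      Cco_of_lt q a y (Nat.cast_lt.2 (h.trans k.lt_succ_self))]
    simp
  · rw [Cco_of_lt q a y (Nat.cast_lt.2 y.lt_succ_self),
      Cco_natCast q a (n := 0) (k := y + 1) (by omega),
      Cco_natCast q a (n := 0) (k := y) (by omega)]
    have h₀ (b : ℝ) : qPoch q b 0 = 1 := by simp [qPoch]
    have := qPoch_self_ne_zero hq y
    have := qPoch_self_ne_zero hq (y + 1)
    simp only [h₀, Nat.cast_add, Nat.cast_one, sub_self, zpow_zero]
    field_simp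
    ring
  obtain ⟨m, rfl⟩ := Nat.exists_eq_add_of_le' (Nat.succ_le_of_lt h)
  rw [Cco_natCast q a (n := m) (k := k + 1) rfl,
    Cco_natCast q a (n := m + 1) (k := k) (by omega),
    Cco_natCast q a (n := m + 1) (k := k + 1) (by omega),
    show ((m + k.succ : ℕ) : ℤ) - (k + 1 : ℕ) = (m : ℤ) by omega,
    show ((m + k.succ : ℕ) : ℤ) + 1 - (k + 1 : ℕ) = ((m + 1 : ℕ) : ℤ) by omega,
    zpow_natCast, zpow_natCast, qPoch_succ q q (m + k.succ), qPoch_succ q q m,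
    qPoch_succ q q k, qPoch_succ q (-a) m]
  have := qPoch_self_ne_zero hq m
  have := qPoch_self_ne_zero hq k
  have hm := one_sub_pow_succ_ne_zero hq m
  have hk := one_sub_pow_succ_ne_zero hq k
  simp only [Nat.succ_eq_add_one, pow_add, pow_one]
  generalize q ^ m = u at *
  generalize q ^ k = v at *
  have hm' : 1 - u * q ≠ 0 := mul_comm q u ▸ hm
  have hk' : 1 - v * q ≠ 0 := mul_comm q v ▸ hk
  field_simp
  ring

theorem stmt_2 (q a : ℝ) (hq : q ∈ Set.Ioo (0:ℝ) 1) (y : ℕ) :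
    ∀ s : ℤ,
      ((q ^ s - 1) * (1 + a * q ^ ((y : ℤ) - s)) * Cco q a y s
          = a * (1 - q ^ ((y : ℤ) + 1 - s)) * Cco q a y (s - 1)) ∧
      (Cco q a (y + 1) s
          = (1 + a * q ^ ((y : ℤ) - s)) * Cco q a y s
            - a * q ^ ((y : ℤ) + 1 - s) * Cco q a y (s - 1)) ∧
      ((1 + a) * Cco q (q * a) y s
          = (1 + a * q ^ ((y : ℤ) - s)) * Cco q a y s
            + a * (1 - q ^ ((y : ℤ) + 1 - s)) * Cco q a y (s - 1)) := by
  intro s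
  refine ⟨Cco_ratio hq a y s, Cco_succ hq a y s, ?_⟩
  rw [one_add_mul_Cco_q_mul]
  linear_combination Cco_ratio hq a y s
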